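/- arXiv:math/0606076 — 3 statements merged into one kernel-verified Lean document; each statement's English description precedes it below -/
import Mathlib

section
/- Let k, ℓ ≥ 1, let s ∈ ℤ^k, s′ ∈ ℤ^ℓ, let r ∈ ℝ_{>0}^k, r′ ∈ ℝ_{>0}^ℓ, and let ε ∈ ℂ with Re(ε) < 0. Then Z(s, r; ε) · Z(s′, r′; ε) = ∑_{(m,α,β)} Z(s″, r″; ε), where the sum runs over all (k,ℓ)-stuffles (m, α, β), and for each such stuffle the merged vectors s″ ∈ ℤ^m, r″ ∈ ℝ_{>0}^m are defined entrywise by s″_u = (s_{α^{-1}(u)} if u ∈ im α, else 0) + (s′_{β^{-1}(u)} if u ∈ im β, else 0) and r″_u = (r_{α^{-1}(u)} if u ∈ im α, else 0) + (r′_{β^{-1}(u)} if u ∈ im β, else 0). (This is the quasi-shuffle/stuffle relation for the directional regularized MZVs.) -/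
open scoped Classical

/-- Strictly decreasing `k`-tuples of positive integers `n₁ > n₂ > ⋯ > n_k > 0`. -/
def DecSeq (k : ℕ) : Type := {n : Fin k → ℕ // StrictAnti n ∧ ∀ i, 0 < n i}

/-- The directional regularized multiple zeta value
`Z(s, r; ε) = ∑_{n₁ > ⋯ > n_k > 0} ∏ᵢ e^{nᵢ rᵢ ε} / nᵢ^{sᵢ}`. -/
noncomputable def Zreg (k : ℕ) (s : Fin k → ℤ) (r : Fin k → ℝ) (ε : ℂ) : ℂ :=
  ∑' n : DecSeq k, ∏ i, Complex.exp ((n.1 i : ℂ) * (r i : ℂ) * ε) / ((n.1 i : ℂ) ^ (s i))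

/-- The factor `e^{n r ε} / n^s` of a term of `Zreg`. -/
noncomputable def zregFactor (ε : ℂ) (s : ℤ) (r : ℝ) (n : ℕ) : ℂ :=
  Complex.exp ((n : ℂ) * (r : ℂ) * ε) / ((n : ℂ) ^ s)

theorem zregFactor_zero (ε : ℂ) (n : ℕ) : zregFactor ε 0 0 n = 1 := by
  simp [zregFactor]

theorem zregFactor_add (ε : ℂ) (s s' : ℤ) (r r' : ℝ) {n : ℕ} (hn : n ≠ 0) :
    zregFactor ε (s + s') (r + r') n = zregFactor ε s r n * zregFactor ε s' r' n := by
  have hn' : (n : ℂ) ≠ 0 := Nat.cast_ne_zero.mpr hn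
  unfold zregFactor
  rw [zpow_add₀ hn', div_mul_div_comm, ← Complex.exp_add]
  congr 2
  push_cast
  ring

theorem zregFactor_sum {ι : Type*} (ε : ℂ) (t : Finset ι) (s : ι → ℤ) (r : ι → ℝ) {n : ℕ}
    (hn : n ≠ 0) :
    zregFactor ε (∑ i ∈ t, s i) (∑ i ∈ t, r i) n = ∏ i ∈ t, zregFactor ε (s i) (r i) n := by
  induction t using Finset.induction_on with
  | empty => simp [zregFactor_zero]
  | insert a t ha ih =>
    rw [Finset.sum_insert ha, Finset.sum_insert ha, Finset.prod_insert ha,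
      zregFactor_add ε _ _ _ _ hn, ih]

theorem prod_zregFactor_fiber_sum {k m : ℕ} (ε : ℂ) (a : Fin k → Fin m) (s : Fin k → ℤ)
    (r : Fin k → ℝ) (N : Fin m → ℕ) (hN : ∀ u, 0 < N u) :
    ∏ u, zregFactor ε (∑ i, if a i = u then s i else 0) (∑ i, if a i = u then r i else 0) (N u) =
      ∏ i, zregFactor ε (s i) (r i) (N (a i)) := by
  have h : ∀ u, zregFactor ε (∑ i, if a i = u then s i else 0)
      (∑ i, if a i = u then r i else 0) (N u) =
      ∏ i, if a i = u then zregFactor ε (s i) (r i) (N u) else 1 := by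
    intro u
    rw [zregFactor_sum ε _ _ _ (hN u).ne']
    refine Finset.prod_congr rfl fun i _ => ?_
    split_ifs
    · rfl
    · exact zregFactor_zero ε _
  simp_rw [h]
  rw [Finset.prod_comm]
  simp

theorem norm_zregFactor_le (ε : ℂ) (s : ℤ) (r : ℝ) (n : ℕ) :
    ‖zregFactor ε s r n‖ ≤ (n : ℝ) ^ s.natAbs * Real.exp (r * ε.re) ^ n := by
  have h1 : ‖Complex.exp ((n : ℂ) * (r : ℂ) * ε)‖ = Real.exp (r * ε.re) ^ n := by
    rw [Complex.norm_exp, ← Real.exp_nat_mul, mul_assoc]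
    congr 1
    simp
  have h2 : ((n : ℝ) ^ s)⁻¹ ≤ (n : ℝ) ^ s.natAbs := by
    rcases Nat.eq_zero_or_pos n with rfl | hn
    · rcases eq_or_ne s 0 with rfl | hs
      · simp
      · simp [zero_zpow s hs]
    · rw [← zpow_neg, ← zpow_natCast]
      exact zpow_le_zpow_right₀ (by exact_mod_cast hn) (by omega)
  unfold zregFactor
  rw [norm_div, h1, norm_zpow, Complex.norm_natCast, div_eq_inv_mul]
  gcongr

theorem summable_norm_zregFactor {ε : ℂ} (hε : ε.re < 0) (s : ℤ) {r : ℝ} (hr : 0 < r) :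
    Summable fun n => ‖zregFactor ε s r n‖ := by
  refine Summable.of_nonneg_of_le (fun _ => norm_nonneg _) (norm_zregFactor_le ε s r) ?_
  refine summable_pow_mul_geometric_of_norm_lt_one _ ?_
  rw [Real.norm_eq_abs, Real.abs_exp, Real.exp_lt_one_iff]
  exact mul_neg_of_pos_of_neg hr hε

theorem summable_pi_prod {ι κ : Type*} [Fintype ι] {f : ι → κ → ℝ}
    (h0 : ∀ i x, 0 ≤ f i x) (hf : ∀ i, Summable (f i)) :
    Summable fun x : ι → κ => ∏ i, f i (x i) := by
  refine summable_of_sum_le (c := ∏ i, ∑' x, f i x)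
    (fun x => Finset.prod_nonneg fun i _ => h0 i _) fun t => ?_
  calc ∑ x ∈ t, ∏ i, f i (x i)
      ≤ ∑ x ∈ Fintype.piFinset fun i => t.image fun x => x i, ∏ i, f i (x i) := by
        refine Finset.sum_le_sum_of_subset_of_nonneg (fun x hx => ?_)
          fun x _ _ => Finset.prod_nonneg fun i _ => h0 i _
        exact Fintype.mem_piFinset.mpr fun i => Finset.mem_image_of_mem _ hx
    _ = ∏ i, ∑ x ∈ t.image fun x => x i, f i x := (Finset.prod_univ_sum _ _).symm
    _ ≤ ∏ i, ∑' x, f i x := by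
        refine Finset.prod_le_prod (fun i _ => Finset.sum_nonneg fun x _ => h0 i x) fun i _ => ?_
        exact (hf i).sum_le_tsum _ fun x _ => h0 i x

theorem summable_norm_zreg {k : ℕ} (s : Fin k → ℤ) {r : Fin k → ℝ} (hr : ∀ i, 0 < r i) {ε : ℂ}
    (hε : ε.re < 0) :
    Summable fun n : DecSeq k => ‖∏ i, zregFactor ε (s i) (r i) (n.1 i)‖ := by
  simp_rw [norm_prod]
  exact (summable_pi_prod (f := fun i n => ‖zregFactor ε (s i) (r i) n‖)
    (fun _ _ => norm_nonneg _) fun i => summable_norm_zregFactor hε (s i) (hr i)).comp_injective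
      (i := fun n : DecSeq k => n.1) Subtype.val_injective

/-- A pair of maps into `Fin m` is a stuffle if both are strictly increasing and they jointly
cover `Fin m`. -/
def IsStuffle {k l m : ℕ} (p : (Fin k → Fin m) × (Fin l → Fin m)) : Prop :=
  StrictMono p.1 ∧ StrictMono p.2 ∧ ∀ u, (∃ i, p.1 i = u) ∨ (∃ j, p.2 j = u)

/-- The `(k, l)`-stuffles, indexed by their length. -/
abbrev Stuffle (k l : ℕ) : Type :=
  Σ m : Finset.Icc (max k l) (k + l), {p : (Fin k → Fin m) × (Fin l → Fin m) // IsStuffle p}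

/-- Restriction of a decreasing sequence along a strictly increasing map. -/
def DecSeq.comp {k m : ℕ} (N : DecSeq m) (a : Fin k → Fin m) (ha : StrictMono a) : DecSeq k :=
  ⟨N.1 ∘ a, N.2.1.comp_strictMono ha, fun i => N.2.2 (a i)⟩

/-- The pair of subsequences that a stuffle extracts from a decreasing sequence. -/
def unstuffle (k l : ℕ) (x : Σ t : Stuffle k l, DecSeq t.1) : DecSeq k × DecSeq l :=
  (x.2.comp x.1.2.1.1 x.1.2.2.1, x.2.comp x.1.2.1.2 x.1.2.2.2.1)

theorem strictAnti_unique {m : ℕ} {N N' : Fin m → ℕ} (hN : StrictAnti N) (hN' : StrictAnti N')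
    (h : Set.range N = Set.range N') : N = N' := by
  have hr : StrictMono (N ∘ Fin.rev) := hN.comp Fin.rev_strictAnti
  have hr' : StrictMono (N' ∘ Fin.rev) := hN'.comp Fin.rev_strictAnti
  have h1 : N ∘ Fin.rev = N' ∘ Fin.rev := by
    refine (hr.range_inj hr').mp ?_
    rw [Fin.rev_surjective.range_comp, Fin.rev_surjective.range_comp, h]
  exact Fin.rev_surjective.injective_comp_right h1

theorem exists_strictAnti_range_eq (S : Finset ℕ) :
    ∃ N : Fin S.card → ℕ, StrictAnti N ∧ Set.range N = S := by
  refine ⟨S.orderEmbOfFin rfl ∘ Fin.rev,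
    (S.orderEmbOfFin rfl).strictMono.comp_strictAnti Fin.rev_strictAnti, ?_⟩
  rw [Fin.rev_surjective.range_comp, Finset.range_orderEmbOfFin]

theorem range_eq_union {k l m : ℕ} {p : (Fin k → Fin m) × (Fin l → Fin m)} (hp : IsStuffle p)
    (N : Fin m → ℕ) : Set.range N = Set.range (N ∘ p.1) ∪ Set.range (N ∘ p.2) := by
  have h : Set.range p.1 ∪ Set.range p.2 = Set.univ := Set.eq_univ_of_forall hp.2.2
  rw [Set.range_comp, Set.range_comp, ← Set.image_union, h, Set.image_univ]

theorem unstuffle_injective (k l : ℕ) : Function.Injective (unstuffle k l) := by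
  rintro ⟨⟨⟨m, hm⟩, ⟨⟨a, b⟩, hp⟩⟩, N⟩ ⟨⟨⟨m', hm'⟩, ⟨⟨a', b'⟩, hp'⟩⟩, N'⟩ h
  have h1 : N.1 ∘ a = N'.1 ∘ a' := congrArg (fun z => z.1.1) h
  have h2 : N.1 ∘ b = N'.1 ∘ b' := congrArg (fun z => z.2.1) h
  have hR : Set.range N.1 = Set.range N'.1 := by
    rw [range_eq_union hp, range_eq_union hp']
    exact congrArg₂ _ (congrArg _ h1) (congrArg _ h2)
  obtain rfl : m = m' := by
    have hc := congrArg Set.ncard hR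
    rw [← Set.image_univ, ← Set.image_univ, Set.ncard_image_of_injective _ N.2.1.injective,
      Set.ncard_image_of_injective _ N'.2.1.injective] at hc
    simpa using hc
  obtain rfl : N = N' := Subtype.ext (strictAnti_unique N.2.1 N'.2.1 hR)
  obtain rfl : a = a' := N.2.1.injective.comp_left h1
  obtain rfl : b = b' := N.2.1.injective.comp_left h2
  rfl

theorem exists_strictMono_comp_eq {k m : ℕ} {N : Fin m → ℕ} (hN : StrictAnti N) {n : Fin k → ℕ}
    (hn : StrictAnti n) (h : Set.range n ⊆ Set.range N) :
    ∃ a : Fin k → Fin m, StrictMono a ∧ N ∘ a = n := by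
  choose a ha using fun i => h ⟨i, rfl⟩
  refine ⟨a, fun i j hij => ?_, funext ha⟩
  rw [← hN.lt_iff_gt, ha, ha]
  exact hn hij

theorem unstuffle_surjective (k l : ℕ) : Function.Surjective (unstuffle k l) := by
  rintro ⟨⟨n, hn, hn0⟩, ⟨n', hn', hn0'⟩⟩
  obtain ⟨S, hS⟩ : ∃ S : Finset ℕ, S = Finset.univ.image n ∪ Finset.univ.image n' := ⟨_, rfl⟩
  have hSr : (S : Set ℕ) = Set.range n ∪ Set.range n' := by simp [hS]
  have hk : (Finset.univ.image n).card = k := by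
    simp [Finset.card_image_of_injective _ hn.injective]
  have hl : (Finset.univ.image n').card = l := by
    simp [Finset.card_image_of_injective _ hn'.injective]
  have hm : S.card ∈ Finset.Icc (max k l) (k + l) := by
    refine Finset.mem_Icc.mpr ⟨max_le ?_ ?_, ?_⟩
    · exact hk.symm.le.trans (hS ▸ Finset.card_le_card Finset.subset_union_left)
    · exact hl.symm.le.trans (hS ▸ Finset.card_le_card Finset.subset_union_right)
    · exact hS ▸ (Finset.card_union_le _ _).trans_eq (congrArg₂ _ hk hl)
  clear hS hk hl
  obtain ⟨N, hN, hNr⟩ := exists_strictAnti_range_eq S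
  rw [hSr] at hNr
  obtain ⟨a, ha, rfl⟩ := exists_strictMono_comp_eq hN hn (hNr ▸ Set.subset_union_left)
  obtain ⟨b, hb, rfl⟩ := exists_strictMono_comp_eq hN hn' (hNr ▸ Set.subset_union_right)
  have hcov : ∀ u, (∃ i, a i = u) ∨ (∃ j, b j = u) := by
    intro u
    have hu : N u ∈ Set.range (N ∘ a) ∪ Set.range (N ∘ b) := hNr ▸ Set.mem_range_self u
    exact hu.imp (fun ⟨i, hi⟩ => ⟨i, hN.injective hi⟩) fun ⟨j, hj⟩ => ⟨j, hN.injective hj⟩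
  have hpos : ∀ u, 0 < N u := by
    intro u
    rcases hcov u with ⟨i, rfl⟩ | ⟨j, rfl⟩
    · exact hn0 i
    · exact hn0' j
  exact ⟨⟨⟨⟨S.card, hm⟩, ⟨(a, b), ha, hb, hcov⟩⟩, ⟨N, hN, hpos⟩⟩, rfl⟩

theorem prod_zregFactor_merge {k l m : ℕ} (ε : ℂ) (p : (Fin k → Fin m) × (Fin l → Fin m))
    (s : Fin k → ℤ) (s' : Fin l → ℤ) (r : Fin k → ℝ) (r' : Fin l → ℝ) (N : DecSeq m) :
    ∏ u, zregFactor ε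
      ((∑ i, if p.1 i = u then s i else 0) + (∑ j, if p.2 j = u then s' j else 0))
      ((∑ i, if p.1 i = u then r i else 0) + (∑ j, if p.2 j = u then r' j else 0)) (N.1 u) =
      (∏ i, zregFactor ε (s i) (r i) (N.1 (p.1 i))) *
        ∏ j, zregFactor ε (s' j) (r' j) (N.1 (p.2 j)) := by
  simp_rw [zregFactor_add ε _ _ _ _ (N.2.2 _).ne']
  rw [Finset.prod_mul_distrib, prod_zregFactor_fiber_sum _ _ _ _ _ N.2.2,
    prod_zregFactor_fiber_sum _ _ _ _ _ N.2.2]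

theorem sum_stuffle {k l : ℕ}
    (F : ∀ m, (Fin k → Fin m) × (Fin l → Fin m) → ℂ) :
    (∑ m ∈ Finset.Icc (max k l) (k + l), ∑ p : (Fin k → Fin m) × (Fin l → Fin m),
      if IsStuffle p then F m p else 0) = ∑ t : Stuffle k l, F t.1 t.2.1 := by
  rw [Fintype.sum_sigma, ← Finset.sum_coe_sort]
  refine Finset.sum_congr rfl fun m _ => ?_
  rw [← Finset.sum_filter]
  exact Finset.sum_subtype _ (by simp) _

theorem tsum_eq_sum_tsum_of_bijective {τ β : Type*} [Fintype τ] {α : τ → Type*} {f : β → ℂ}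
    (hf : Summable f) {e : (Σ t, α t) → β} (he : Function.Bijective e) :
    ∑' b, f b = ∑ t, ∑' a, f (e ⟨t, a⟩) := by
  have hfe : Summable fun x => f (e x) := hf.comp_injective he.injective
  rw [← (Equiv.ofBijective e he).tsum_eq f]
  exact hfe.tsum_sigma.trans (tsum_fintype _)

/-- The quasi-shuffle (stuffle) relation for directional regularized MZVs:
`Z(s,r;ε)·Z(s',r';ε)` is the sum, over all `(k,ℓ)`-stuffles `(m, α, β)` (order-preserving
injections `α, β` into `{1,…,m}` with covering ranges), of `Z(s'',r'';ε)` for the merged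
argument vectors. -/
theorem Zreg_quasi_shuffle (k l : ℕ) (hk : 1 ≤ k) (hl : 1 ≤ l)
    (s : Fin k → ℤ) (s' : Fin l → ℤ) (r : Fin k → ℝ) (r' : Fin l → ℝ)
    (hr : ∀ i, 0 < r i) (hr' : ∀ j, 0 < r' j) (ε : ℂ) (hε : ε.re < 0) :
    Zreg k s r ε * Zreg l s' r' ε =
      ∑ m ∈ Finset.Icc (max k l) (k + l),
        ∑ p : (Fin k → Fin m) × (Fin l → Fin m),
          if StrictMono p.1 ∧ StrictMono p.2 ∧ ∀ u, (∃ i, p.1 i = u) ∨ (∃ j, p.2 j = u) then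
            Zreg m
              (fun u => (∑ i, if p.1 i = u then s i else 0)
                + (∑ j, if p.2 j = u then s' j else 0))
              (fun u => (∑ i, if p.1 i = u then r i else 0)
                + (∑ j, if p.2 j = u then r' j else 0)) ε
          else 0 := by
  let g : DecSeq k → ℂ := fun n => ∏ i, zregFactor ε (s i) (r i) (n.1 i)
  let g' : DecSeq l → ℂ := fun n => ∏ j, zregFactor ε (s' j) (r' j) (n.1 j)
  let f : DecSeq k × DecSeq l → ℂ := fun n => g n.1 * g' n.2
  have hg : Summable fun n => ‖g n‖ := summable_norm_zreg s hr hε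
  have hg' : Summable fun n => ‖g' n‖ := summable_norm_zreg s' hr' hε
  have hf : Summable f := summable_mul_of_summable_norm hg hg'
  calc Zreg k s r ε * Zreg l s' r' ε = ∑' n, f n :=
        tsum_mul_tsum_of_summable_norm hg hg'
    _ = ∑ t : Stuffle k l, ∑' N : DecSeq t.1, f (unstuffle k l ⟨t, N⟩) :=
        tsum_eq_sum_tsum_of_bijective hf ⟨unstuffle_injective k l, unstuffle_surjective k l⟩
    _ = ∑ t : Stuffle k l, Zreg t.1
          (fun u => (∑ i, if t.2.1.1 i = u then s i else 0)
            + (∑ j, if t.2.1.2 j = u then s' j else 0))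
          (fun u => (∑ i, if t.2.1.1 i = u then r i else 0)
            + (∑ j, if t.2.1.2 j = u then r' j else 0)) ε :=
        Finset.sum_congr rfl fun t _ => tsum_congr fun N =>
          (prod_zregFactor_merge ε t.2.1 s s' r r' N).symm
    _ = _ := by
        rw [← sum_stuffle fun m p => Zreg m
          (fun u => (∑ i, if p.1 i = u then s i else 0)
            + (∑ j, if p.2 j = u then s' j else 0))
          (fun u => (∑ i, if p.1 i = u then r i else 0)
            + (∑ j, if p.2 j = u then r' j else 0)) ε]
        exact Finset.sum_congr rfl fun m _ => Finset.sum_congr rfl fun p _ =>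
          if_congr Iff.rfl rfl rfl
end

section
/- Let k ≥ 1, let s_1, …, s_{k+1} ∈ ℤ, let r_1, …, r_{k+1} be positive reals, and let ε ∈ ℂ with Re(ε) < 0. Then ( ∑_{σ ∈ S_k} Z((s_{σ(1)}, …, s_{σ(k)}), (r_{σ(1)}, …, r_{σ(k)}); ε) ) · Z((s_{k+1}), (r_{k+1}); ε) = ∑_{τ ∈ S_{k+1}} Z((s_{τ(1)}, …, s_{τ(k+1)}), (r_{τ(1)}, …, r_{τ(k+1)}); ε) + ∑_{i=1}^{k} ∑_{σ ∈ S_k} Z((s_{σ(1)}, …, s_{σ(i)} + s_{k+1}, …, s_{σ(k)}), (r_{σ(1)}, …, r_{σ(i)} + r_{k+1}, …, r_{σ(k)}); ε), where S_n denotes the symmetric group on {1,…,n}. (This is the analytic form, under the evaluation map Z, of the symmetrization identity a^{(Σ_k)} ∗ (a_{k+1}) = (a_1,…,a_k,a_{k+1})^{(Σ_{k+1})} + ∑_i (a_1,…,a_i a_{k+1},…,a_k)^{(Σ_k)} for the quasi-shuffle product.) -/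
/-- The Dirichlet-type term attached to the letter `(s, r)`. -/
noncomputable def zregTerm (ε : ℂ) (s : ℤ) (r : ℝ) (n : ℕ+) : ℂ :=
  Complex.exp ((n : ℕ) * (r : ℂ) * ε) / (((n : ℕ) : ℂ) ^ s)

theorem zregTerm_mul (ε : ℂ) (s s' : ℤ) (r r' : ℝ) (n : ℕ+) :
    zregTerm ε s r n * zregTerm ε s' r' n = zregTerm ε (s + s') (r + r') n := by
  have hn : ((n : ℕ) : ℂ) ≠ 0 := by exact_mod_cast n.pos.ne'
  rw [zregTerm, zregTerm, zregTerm, zpow_add₀ hn, div_mul_div_comm, ← Complex.exp_add]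
  push_cast
  ring_nf

theorem summable_norm_zregTerm {ε : ℂ} (hε : ε.re < 0) (s : ℤ) {r : ℝ} (hr : 0 < r) :
    Summable fun n : ℕ+ => ‖zregTerm ε s r n‖ := by
  have hc : 0 < r * -ε.re := mul_pos hr (neg_pos.mpr hε)
  have h := (Real.summable_pow_mul_exp_neg_nat_mul s.natAbs hc).comp_injective
    PNat.coe_injective
  refine h.of_nonneg_of_le (fun _ => norm_nonneg _) fun n => ?_
  have hn : (1 : ℝ) ≤ (n : ℕ) := by exact_mod_cast Nat.one_le_iff_ne_zero.mpr n.ne_zero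
  have hre : (((n : ℕ) : ℂ) * (r : ℂ) * ε).re = -(r * -ε.re) * (n : ℕ) := by
    simp [Complex.mul_re]
    ring
  rw [zregTerm, norm_div, Complex.norm_exp, hre, norm_zpow, Complex.norm_natCast, div_eq_mul_inv,
    ← zpow_neg, mul_comm, Function.comp_apply]
  gcongr
  rw [← zpow_natCast]
  exact zpow_le_zpow_right₀ hn (by omega)

theorem summable_norm_prod_apply {k : ℕ} {ι : Type*} {a : Fin k → ι → ℂ}
    (ha : ∀ i, Summable fun n => ‖a i n‖) :
    Summable fun m : Fin k → ι => ‖∏ i, a i (m i)‖ := by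
  induction k with
  | zero => exact Summable.of_finite
  | succ k ih =>
    rw [← (Fin.snocEquiv fun _ => ι).summable_iff]
    refine ((ha (Fin.last k)).mul_of_nonneg (ih fun i => ha i.castSucc)
      (fun _ => norm_nonneg _) (fun _ => norm_nonneg _)).congr fun p => ?_
    simp [Fin.prod_univ_castSucc, mul_comm]

theorem summable_ite_prod_apply {k : ℕ} {ι : Type*} {a : Fin k → ι → ℂ}
    (ha : ∀ i, Summable fun n => ‖a i n‖) (P : (Fin k → ι) → Prop) [DecidablePred P] :
    Summable fun m : Fin k → ι => if P m then ∏ i, a i (m i) else 0 := by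
  refine Summable.of_norm_bounded (summable_norm_prod_apply ha) fun m => ?_
  split_ifs
  · exact le_rfl
  · exact norm_zero.trans_le (norm_nonneg _)

theorem existsUnique_perm_strictAnti_iff {k : ℕ} {ι : Type*} [LinearOrder ι] (m : Fin k → ι) :
    (∃! σ : Equiv.Perm (Fin k), StrictAnti (m ∘ σ)) ↔ Function.Injective m := by
  constructor
  · rintro ⟨σ, hσ, -⟩
    simpa using hσ.injective
  · intro hm
    refine ⟨Tuple.sort (OrderDual.toDual ∘ m), ?_, fun τ hτ => ?_⟩
    · have h : Antitone (m ∘ Tuple.sort (OrderDual.toDual ∘ m)) :=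
        Tuple.monotone_sort (OrderDual.toDual ∘ m)
      exact h.strictAnti_of_injective (hm.comp (Equiv.injective _))
    · have h : (OrderDual.toDual ∘ m) ∘ τ = _ := Tuple.unique_monotone
        (f := OrderDual.toDual ∘ m) (σ := τ) (τ := Tuple.sort (OrderDual.toDual ∘ m))
        hτ.antitone (Tuple.monotone_sort _)
      exact Equiv.ext fun i => hm (congrFun h i)

open Classical in
theorem sum_perm_tsum_strictAnti {k : ℕ} {ι : Type*} [LinearOrder ι] {a : Fin k → ι → ℂ}
    (ha : ∀ i, Summable fun n => ‖a i n‖) :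
    ∑ σ : Equiv.Perm (Fin k), ∑' m : Fin k → ι,
        (if StrictAnti m then ∏ i, a (σ i) (m i) else 0) =
      ∑' m : Fin k → ι, if Function.Injective m then ∏ i, a i (m i) else 0 := by
  have h (σ : Equiv.Perm (Fin k)) : ∑' m : Fin k → ι,
      (if StrictAnti m then ∏ i, a (σ i) (m i) else 0) =
      ∑' m : Fin k → ι, if StrictAnti (m ∘ σ) then ∏ i, a i (m i) else 0 := by
    rw [← (Equiv.arrowCongr σ.symm (Equiv.refl ι)).tsum_eq]
    refine tsum_congr fun m => ?_
    rw [← Equiv.prod_comp σ fun i => a i (m i)]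
    rfl
  simp_rw [h]
  rw [← Summable.tsum_finsetSum fun σ _ => summable_ite_prod_apply ha _]
  refine tsum_congr fun m => ?_
  split_ifs with hm
  · obtain ⟨σ, hσ, huniq⟩ := (existsUnique_perm_strictAnti_iff m).2 hm
    rw [Finset.sum_eq_single σ (fun τ _ hτ => if_neg fun h' => hτ (huniq τ h')) (by simp),
      if_pos hσ]
  · refine Finset.sum_eq_zero fun σ _ => if_neg fun h' => hm ?_
    simpa using h'.injective

open Classical in
theorem Zreg_eq_tsum (k : ℕ) (s : Fin k → ℤ) (r : Fin k → ℝ) (ε : ℂ) :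
    Zreg k s r ε = ∑' m : Fin k → ℕ+,
      if StrictAnti m then ∏ i, zregTerm ε (s i) (r i) (m i) else 0 := by
  let e : {m : Fin k → ℕ+ // StrictAnti m} ≃ DecSeq k :=
    { toFun := fun m => ⟨fun i => m.1 i, fun i j h => m.2 h, fun i => (m.1 i).pos⟩
      invFun := fun n => ⟨fun i => ⟨n.1 i, n.2.2 i⟩, fun i j h => n.2.1 h⟩
      left_inv := fun _ => rfl
      right_inv := fun _ => rfl }
  rw [Zreg, ← e.tsum_eq]
  refine (tsum_subtype {m : Fin k → ℕ+ | StrictAnti m}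
    fun m => ∏ i, zregTerm ε (s i) (r i) (m i)).trans (tsum_congr fun m => ?_)
  simp [Set.indicator_apply]

theorem tsum_injective_mul_tsum {k : ℕ} {ι : Type*} [DecidableEq ι] {a : Fin (k + 1) → ι → ℂ}
    (ha : ∀ i, Summable fun n => ‖a i n‖) :
    (∑' m : Fin k → ι, if Function.Injective m then ∏ i, a i.castSucc (m i) else 0) *
        ∑' n, a (Fin.last k) n =
      (∑' m : Fin (k + 1) → ι, if Function.Injective m then ∏ i, a i (m i) else 0) +
      ∑ j : Fin k, ∑' m : Fin k → ι, if Function.Injective m then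
        ∏ i, (if i = j then a i.castSucc (m i) * a (Fin.last k) (m i)
          else a i.castSucc (m i)) else 0 := by
  let e : (Fin k → ι) × ι ≃ (Fin (k + 1) → ι) :=
    (Equiv.prodComm _ _).trans (Fin.snocEquiv fun _ => ι)
  have he (p) : e p = Fin.snoc p.1 p.2 := rfl
  have hF : Summable fun m : Fin k → ι =>
      ‖if Function.Injective m then ∏ i, a i.castSucc (m i) else 0‖ :=
    (summable_ite_prod_apply (fun i => ha i.castSucc) _).norm
  have hprod := summable_mul_of_summable_norm hF (ha (Fin.last k))
  have hsplit (p : (Fin k → ι) × ι) :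
      (if Function.Injective p.1 then ∏ i, a i.castSucc (p.1 i) else 0) * a (Fin.last k) p.2 =
      (if Function.Injective (e p) then
        ∏ i, a i ((e p) i) else 0) +
      ∑ j : Fin k, if p.2 = p.1 j then
        (if Function.Injective p.1 then ∏ i, a i.castSucc (p.1 i) else 0) * a (Fin.last k) p.2
        else 0 := by
    obtain ⟨m, n⟩ := p
    simp only [he, Fin.snoc_injective_iff, Fin.prod_univ_castSucc, Fin.snoc_castSucc, Fin.snoc_last]
    by_cases hm : Function.Injective m
    · by_cases hn : n ∈ Set.range m
      · obtain ⟨j, rfl⟩ := hn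
        simp [hm, hm.eq_iff]
      · have hn' (j : Fin k) : n ≠ m j := fun h => hn ⟨j, h.symm⟩
        simp [hm, hn, hn']
    · simp [hm]
  have hdiag (j : Fin k) : Summable fun p : (Fin k → ι) × ι => if p.2 = p.1 j then
      (if Function.Injective p.1 then ∏ i, a i.castSucc (p.1 i) else 0) * a (Fin.last k) p.2
      else 0 := by
    refine Summable.of_norm_bounded hprod.norm fun p => ?_
    by_cases h : p.2 = p.1 j
    · rw [if_pos h]
    · rw [if_neg h]
      exact norm_zero.trans_le (norm_nonneg _)
  have hsnoc : Summable fun p => if Function.Injective (e p) then ∏ i, a i (e p i) else 0 :=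
    (e.summable_iff (f := fun m : Fin (k + 1) → ι =>
    if Function.Injective m then ∏ i, a i (m i) else 0)).mpr (summable_ite_prod_apply ha _)
  rw [tsum_mul_tsum_of_summable_norm hF (ha (Fin.last k)), tsum_congr hsplit,
    Summable.tsum_add hsnoc (summable_sum fun j _ => hdiag j),
    Summable.tsum_finsetSum fun j _ => hdiag j, ← e.tsum_eq]
  congr 1
  · refine Finset.sum_congr rfl fun j _ => ?_
    rw [(hdiag j).tsum_prod]
    refine tsum_congr fun m => ?_
    rw [tsum_ite_eq]
    split_ifs
    · have h (i : Fin k) : (if i = j then a i.castSucc (m i) * a (Fin.last k) (m i)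
          else a i.castSucc (m i)) =
          a i.castSucc (m i) * if i = j then a (Fin.last k) (m i) else 1 := by
        split_ifs <;> simp
      rw [Finset.prod_congr rfl fun i _ => h i, Finset.prod_mul_distrib, Finset.prod_ite_eq',
        if_pos (Finset.mem_univ j)]
    · simp

/-- The symmetrization identity (analytic form of
`a^{(Σ_k)} ∗ (a_{k+1}) = (a₁,…,a_{k+1})^{(Σ_{k+1})} + ∑ᵢ (a₁,…,aᵢa_{k+1},…,a_k)^{(Σ_k)}`
under the evaluation map `Z`). -/
theorem Zreg_symmetrization (k : ℕ) (hk : 1 ≤ k)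
    (s : Fin (k + 1) → ℤ) (r : Fin (k + 1) → ℝ) (hr : ∀ i, 0 < r i)
    (ε : ℂ) (hε : ε.re < 0) :
    (∑ σ : Equiv.Perm (Fin k),
        Zreg k (fun i => s (Fin.castSucc (σ i))) (fun i => r (Fin.castSucc (σ i))) ε) *
      Zreg 1 (fun _ => s (Fin.last k)) (fun _ => r (Fin.last k)) ε =
    (∑ τ : Equiv.Perm (Fin (k + 1)),
        Zreg (k + 1) (fun i => s (τ i)) (fun i => r (τ i)) ε) +
    ∑ i : Fin k, ∑ σ : Equiv.Perm (Fin k),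
        Zreg k
          (fun t => if t = i then s (Fin.castSucc (σ t)) + s (Fin.last k)
            else s (Fin.castSucc (σ t)))
          (fun t => if t = i then r (Fin.castSucc (σ t)) + r (Fin.last k)
            else r (Fin.castSucc (σ t))) ε := by
  classical
  let a : Fin (k + 1) → ℕ+ → ℂ := fun i => zregTerm ε (s i) (r i)
  have ha (i) : Summable fun n => ‖a i n‖ := summable_norm_zregTerm hε (s i) (hr i)
  let b : Fin k → Fin k → ℕ+ → ℂ := fun j i n =>
    if i = j then a i.castSucc n * a (Fin.last k) n else a i.castSucc n
  have hb (j i) : Summable fun n => ‖b j i n‖ := by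
    by_cases h : i = j
    · simp only [b, h, if_true, a, zregTerm_mul]
      exact summable_norm_zregTerm hε _ (add_pos (hr _) (hr _))
    · simpa only [b, h, if_false] using ha i.castSucc
  have hone : Zreg 1 (fun _ => s (Fin.last k)) (fun _ => r (Fin.last k)) ε =
      ∑' n, a (Fin.last k) n := by
    rw [Zreg_eq_tsum, ← (Equiv.funUnique (Fin 1) ℕ+).tsum_eq]
    refine tsum_congr fun m => ?_
    simp [Subsingleton.strictAnti, a]
  have hmerge : (∑ i : Fin k, ∑ σ : Equiv.Perm (Fin k),
        Zreg k
          (fun t => if t = i then s (Fin.castSucc (σ t)) + s (Fin.last k)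
            else s (Fin.castSucc (σ t)))
          (fun t => if t = i then r (Fin.castSucc (σ t)) + r (Fin.last k)
            else r (Fin.castSucc (σ t))) ε) =
      ∑ j : Fin k, ∑ σ : Equiv.Perm (Fin k), ∑' m : Fin k → ℕ+,
        if StrictAnti m then ∏ t, b j (σ t) (m t) else 0 := by
    refine Finset.sum_comm.trans (Eq.trans ?_ Finset.sum_comm)
    refine Finset.sum_congr rfl fun σ _ => Eq.trans ?_ (Equiv.sum_comp σ _)
    refine Finset.sum_congr rfl fun i _ => ?_
    rw [Zreg_eq_tsum]
    refine tsum_congr fun m => ?_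
    congr 1
    refine Finset.prod_congr rfl fun t _ => ?_
    by_cases h : t = i <;> simp [b, a, h, zregTerm_mul]
  rw [hone, hmerge]
  simp_rw [Zreg_eq_tsum]
  rw [sum_perm_tsum_strictAnti (a := fun i => a i.castSucc) fun i => ha i.castSucc,
    sum_perm_tsum_strictAnti ha, tsum_injective_mul_tsum ha]
  congr 1
  exact Finset.sum_congr rfl fun j _ => (sum_perm_tsum_strictAnti (hb j)).symm
end

section
/- Let s₁, s₂ be integers with s₁ ≤ 0, s₂ < 0, and s₁ + s₂ odd. Then ζ(s₁ + s₂ − 1) = 0, and each summand of ∑_{q=1}^{−s₁} (s₁)_q·((−1)^q/q!)·ζ(−q)·ζ(s₁ + s₂ + q) vanishes, so that −ζ(s₁ + s₂ − 1)/(1 − s₁) − ζ(s₁ + s₂)/2 + ∑_{q=1}^{−s₁} (s₁)_q·((−1)^q/q!)·ζ(−q)·ζ(s₁ + s₂ + q) = −ζ(s₁ + s₂)/2. (This identity evaluates the Akiyama–Tanigawa formula for the analytically continued double zeta value ζ(s₁, s₂) at nonpositive arguments with s₁ + s₂ negative odd, giving ζ(s₁, s₂) = −ζ(s₁ + s₂)/2.)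 -/
open Complex

/-- `ζ` vanishes at negative even integers. -/
theorem riemannZeta_intCast_eq_zero {n : ℤ} (hn : n < 0) (heven : Even n) :
    riemannZeta (n : ℂ) = 0 := by
  obtain ⟨m, rfl⟩ := heven
  obtain ⟨k, hk⟩ := Int.eq_ofNat_of_zero_le (show 0 ≤ -m - 1 by omega)
  obtain rfl : m = -(k + 1 : ℤ) := by omega
  convert riemannZeta_neg_two_mul_nat_add_one k using 2
  push_cast
  ring

/-- For nonpositive integers `s₁ ≤ 0`, `s₂ < 0` with `s₁ + s₂` odd: `ζ(s₁+s₂-1) = 0`, every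
summand of the Akiyama–Tanigawa sum `∑_{q=1}^{-s₁} (s₁)_q ((-1)^q/q!) ζ(-q) ζ(s₁+s₂+q)`
vanishes, and hence
`-ζ(s₁+s₂-1)/(1-s₁) - ζ(s₁+s₂)/2 + ∑_{q=1}^{-s₁} (s₁)_q ((-1)^q/q!) ζ(-q) ζ(s₁+s₂+q)
  = -ζ(s₁+s₂)/2`. -/
theorem akiyama_tanigawa_odd_evaluation (s₁ s₂ : ℤ) (h₁ : s₁ ≤ 0) (h₂ : s₂ < 0)
    (hodd : Odd (s₁ + s₂)) :
    riemannZeta ((s₁ : ℂ) + (s₂ : ℂ) - 1) = 0 ∧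
    (∀ q ∈ Finset.Icc 1 (-s₁).toNat,
      (∏ t ∈ Finset.range q, ((s₁ : ℂ) + (t : ℂ))) * ((-1 : ℂ) ^ q / (Nat.factorial q : ℂ)) *
        riemannZeta (-(q : ℂ)) * riemannZeta ((s₁ : ℂ) + (s₂ : ℂ) + (q : ℂ)) = 0) ∧
    -riemannZeta ((s₁ : ℂ) + (s₂ : ℂ) - 1) / (1 - (s₁ : ℂ))
        - riemannZeta ((s₁ : ℂ) + (s₂ : ℂ)) / 2
        + ∑ q ∈ Finset.Icc 1 (-s₁).toNat,
            (∏ t ∈ Finset.range q, ((s₁ : ℂ) + (t : ℂ))) *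
              ((-1 : ℂ) ^ q / (Nat.factorial q : ℂ)) *
              riemannZeta (-(q : ℂ)) * riemannZeta ((s₁ : ℂ) + (s₂ : ℂ) + (q : ℂ))
      = -riemannZeta ((s₁ : ℂ) + (s₂ : ℂ)) / 2 := by
  have hzero : riemannZeta ((s₁ : ℂ) + (s₂ : ℂ) - 1) = 0 := by
    exact_mod_cast riemannZeta_intCast_eq_zero (n := s₁ + s₂ - 1) (by omega)
      (hodd.sub_odd odd_one)
  have hterm : ∀ q ∈ Finset.Icc 1 (-s₁).toNat,
      (∏ t ∈ Finset.range q, ((s₁ : ℂ) + (t : ℂ))) * ((-1 : ℂ) ^ q / (Nat.factorial q : ℂ)) *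
        riemannZeta (-(q : ℂ)) * riemannZeta ((s₁ : ℂ) + (s₂ : ℂ) + (q : ℂ)) = 0 := by
    intro q hq
    rw [Finset.mem_Icc] at hq
    rcases Nat.even_or_odd q with hq' | hq'
    · have h : riemannZeta (-(q : ℂ)) = 0 := by
        exact_mod_cast riemannZeta_intCast_eq_zero (n := -(q : ℤ)) (by omega)
          ((Int.even_coe_nat q).2 hq').neg
      rw [h, mul_zero, zero_mul]
    · have h : riemannZeta ((s₁ : ℂ) + (s₂ : ℂ) + (q : ℂ)) = 0 := by
        exact_mod_cast riemannZeta_intCast_eq_zero (n := s₁ + s₂ + q) (by omega)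
          (hodd.add_odd ((Int.odd_coe_nat q).2 hq'))
      rw [h, mul_zero]
  refine ⟨hzero, hterm, ?_⟩
  rw [Finset.sum_eq_zero hterm, hzero]
  ring
end
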